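/- arXiv:1705.07892 — 10 statements merged into one kernel-verified Lean document; each statement's English description precedes it below -/
import Mathlib

section
/- Let K, N be positive integers with N ≥ K, let λ_1, …, λ_K ∈ ℂ be pairwise distinct, let c_1, …, c_K ∈ ℂ be all nonzero, and let f : ℕ → ℂ be f(x) = Σ_{k=1}^K c_k λ_k^x. Then the N×N Hankel matrix H with entries H(m,n) = f(m+n), 0 ≤ m,n ≤ N−1, has rank exactly K. -/
open Matrix

/-- If `N ≥ K`, the `λ k` are pairwise distinct and the `c k` are all nonzero,
then the N×N Hankel matrix generated by `f(x) = ∑ k, c k * λ k ^ x` has rank exactly `K`. -/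
theorem hankel_rank_eq
    (K N : ℕ) (hK : 0 < K) (hN : 0 < N) (hNK : K ≤ N)
    (lam : Fin K → ℂ) (hdist : Function.Injective lam)
    (c : Fin K → ℂ) (hc : ∀ k, c k ≠ 0)
    (f : ℕ → ℂ)
    (hf : ∀ x : ℕ, f x = ∑ k, c k * lam k ^ x)
    (H : Matrix (Fin N) (Fin N) ℂ)
    (hH : ∀ m n : Fin N, H m n = f ((m : ℕ) + (n : ℕ))) :
    H.rank = K := by
  apply le_antisymm
  · have h : H = (Matrix.of fun (m : Fin N) (k : Fin K) => c k * lam k ^ (m : ℕ)) *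
        (Matrix.of fun (k : Fin K) (n : Fin N) => lam k ^ (n : ℕ)) := by
      ext m n
      simp only [hH, hf, Matrix.mul_apply, Matrix.of_apply, pow_add, mul_assoc]
    rw [h]
    exact (rank_mul_le_left _ _).trans (rank_le_width _)
  · have h : H.submatrix (Fin.castLE hNK) (Fin.castLE hNK) =
        (vandermonde lam)ᵀ * (diagonal c * vandermonde lam) := by
      ext m n
      rw [Matrix.mul_apply]
      simp only [submatrix_apply, hH, hf, diagonal_mul, transpose_apply,
        vandermonde_apply, Fin.val_castLE, pow_add]
      exact Finset.sum_congr rfl fun k _ => by ring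
    have hu : IsUnit ((vandermonde lam)ᵀ * (diagonal c * vandermonde lam)) := by
      rw [isUnit_iff_isUnit_det, isUnit_iff_ne_zero, det_mul, det_mul, det_transpose,
        det_diagonal]
      have hv := det_vandermonde_ne_zero_iff.mpr hdist
      exact mul_ne_zero hv (mul_ne_zero (Finset.prod_ne_zero_iff.mpr fun k _ => hc k) hv)
    have hr := rank_of_isUnit _ hu
    rw [← h, Fintype.card_fin] at hr
    exact hr.symm.le.trans (rank_submatrix_le _ _ _)
end

section
/- Let K, N be positive integers with N ≥ K, let λ_1, …, λ_K ∈ ℂ be pairwise distinct, let c_1, …, c_K ∈ ℂ be all nonzero, and let f : ℕ → ℂ be f(x) = Σ_{k=1}^K c_k λ_k^x. Then the column space of the N×N Hankel matrix H with entries H(m,n) = f(m+n) equals the linear span of the K columns of the Vandermonde matrix Λ with Λ(j,k) = λ_k^j, 0 ≤ j ≤ N−1. Consequently, every N×K matrix U whose columns form a basis of the column space of H can be written U = Λ B for a unique invertible K×K matrix B. -/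
open Matrix

/-- Under the hypotheses of Statement 1, the column space of the Hankel matrix
`H` equals the span of the columns of the Vandermonde matrix `Λ`; consequently any `N×K`
matrix `U` whose columns form a basis of the column space of `H` can be written `U = Λ * B`
for a unique invertible `K×K` matrix `B`. -/
theorem hankel_column_space_eq_vandermonde_span
    (K N : ℕ) (hK : 0 < K) (hN : 0 < N) (hNK : K ≤ N)
    (lam : Fin K → ℂ) (hdist : Function.Injective lam)
    (c : Fin K → ℂ) (hc : ∀ k, c k ≠ 0)
    (f : ℕ → ℂ)
    (hf : ∀ x : ℕ, f x = ∑ k, c k * lam k ^ x)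
    (H : Matrix (Fin N) (Fin N) ℂ)
    (hH : ∀ m n : Fin N, H m n = f ((m : ℕ) + (n : ℕ)))
    (Λ : Matrix (Fin N) (Fin K) ℂ)
    (hΛ : ∀ (j : Fin N) (k : Fin K), Λ j k = lam k ^ (j : ℕ)) :
    LinearMap.range H.mulVecLin = Submodule.span ℂ (Set.range Λᵀ) ∧
    ∀ U : Matrix (Fin N) (Fin K) ℂ,
      LinearIndependent ℂ (fun k : Fin K => Uᵀ k) →
      Submodule.span ℂ (Set.range Uᵀ) = LinearMap.range H.mulVecLin →
      ∃! B : Matrix (Fin K) (Fin K) ℂ, IsUnit B ∧ U = Λ * B := by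
  classical
  have hL : ∃ L : Matrix (Fin K) (Fin N) ℂ, L * Λ = 1 := by
    let S : Matrix (Fin K) (Fin N) ℂ :=
      (1 : Matrix (Fin N) (Fin N) ℂ).submatrix (Fin.castLE hNK) id
    have hS : S * Λ = (Matrix.vandermonde lam)ᵀ := by
      ext i k
      simp [S, Matrix.mul_apply, Matrix.one_apply, hΛ, Matrix.vandermonde_apply]
    have hu : IsUnit ((Matrix.vandermonde lam)ᵀ).det := by
      rw [Matrix.det_transpose, isUnit_iff_ne_zero]
      exact Matrix.det_vandermonde_ne_zero_iff.mpr hdist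
    refine ⟨((Matrix.vandermonde lam)ᵀ)⁻¹ * S, ?_⟩
    rw [Matrix.mul_assoc, hS, Matrix.nonsing_inv_mul _ hu]
  obtain ⟨L, hL⟩ := hL
  have hHf : H = Λ * (Matrix.diagonal c * Λᵀ) := by
    ext m n
    rw [hH, hf, Matrix.mul_apply]
    refine Finset.sum_congr rfl fun k _ => ?_
    rw [Matrix.diagonal_mul, Matrix.transpose_apply, hΛ, hΛ, pow_add]
    ring
  have hΛH : Λ = H * (Lᵀ * Matrix.diagonal (fun k => (c k)⁻¹)) := by
    have h1 : Λᵀ * Lᵀ = 1 := by rw [← Matrix.transpose_mul, hL, Matrix.transpose_one]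
    have h2 : Matrix.diagonal c * Matrix.diagonal (fun k => (c k)⁻¹) = 1 := by
      rw [Matrix.diagonal_mul_diagonal, ← Matrix.diagonal_one]
      congr 1
      funext k
      exact mul_inv_cancel₀ (hc k)
    calc Λ = Λ * (Matrix.diagonal c * ((Λᵀ * Lᵀ) * Matrix.diagonal (fun k => (c k)⁻¹))) := by
            rw [h1, Matrix.one_mul, h2, Matrix.mul_one]
      _ = _ := by rw [hHf]; simp only [Matrix.mul_assoc]
  have hspan : Submodule.span ℂ (Set.range Λᵀ) = LinearMap.range Λ.mulVecLin :=
    (Matrix.range_mulVecLin Λ).symm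
  have hrange : LinearMap.range H.mulVecLin = LinearMap.range Λ.mulVecLin := by
    apply le_antisymm
    · rw [hHf, Matrix.mulVecLin_mul]
      exact LinearMap.range_comp_le_range _ _
    · conv_lhs => rw [hΛH, Matrix.mulVecLin_mul]
      exact LinearMap.range_comp_le_range _ _
  refine ⟨hrange.trans hspan.symm, ?_⟩
  intro U hU hUs
  have hmem : ∀ k, ∃ b, Λ *ᵥ b = Uᵀ k := by
    intro k
    have h : Uᵀ k ∈ LinearMap.range Λ.mulVecLin := by
      rw [← hrange, ← hUs]
      exact Submodule.subset_span ⟨k, rfl⟩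
    exact h
  choose b hb using hmem
  have hUB : U = Λ * (Matrix.of b)ᵀ := by
    ext i k
    exact (congrFun (hb k) i).symm
  refine ⟨(Matrix.of b)ᵀ, ⟨?_, hUB⟩, ?_⟩
  · rw [← Matrix.mulVec_injective_iff_isUnit]
    have hi : Function.Injective U.mulVec := Matrix.mulVec_injective_iff.mpr hU
    intro x y hxy
    apply hi
    rw [hUB, ← Matrix.mulVec_mulVec, ← Matrix.mulVec_mulVec]
    exact congrArg _ hxy
  · rintro B ⟨_, hB⟩
    have h := congrArg (L * ·) (hB.symm.trans hUB)
    simpa only [← Matrix.mul_assoc, hL, Matrix.one_mul] using h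
end

section
/- Let λ_1,…,λ_K ∈ ℂ, let Λ be the N×K Vandermonde matrix with Λ(j,k) = λ_k^j for 0 ≤ j ≤ N−1, and assume the columns of Λ_− (the matrix Λ with its last row deleted) are linearly independent. Let B be an invertible K×K complex matrix and set U = Λ B. Then the K×K matrix U_−^* U_− is invertible and (U_−^* U_−)^{−1} U_−^* U_+ = B^{−1} D B, where D = diag(λ_1,…,λ_K), U_− is U with its last row deleted, and U_+ is U with its first row deleted. -/
open Matrix

/-- If the columns of `Λ₋` are linearly independent, `B` is invertible and
`U = Λ * B`, then `U₋ᴴ U₋` is invertible and `(U₋ᴴ U₋)⁻¹ U₋ᴴ U₊ = B⁻¹ D B` with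
`D = diag(λ_1,…,λ_K)`. -/
theorem esprit_rotation_identity
    (K N : ℕ) (hK : 0 < K) (hN : 0 < N)
    (lam : Fin K → ℂ)
    (Λ : Matrix (Fin N) (Fin K) ℂ)
    (hΛ : ∀ (j : Fin N) (k : Fin K), Λ j k = lam k ^ (j : ℕ))
    (Λm : Matrix (Fin (N - 1)) (Fin K) ℂ)
    (hΛm : ∀ (j : Fin (N - 1)) (k : Fin K),
      Λm j k = Λ ⟨(j : ℕ), by have := j.isLt; omega⟩ k)
    (hind : LinearIndependent ℂ (fun k : Fin K => Λmᵀ k))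
    (B : Matrix (Fin K) (Fin K) ℂ) (hB : IsUnit B)
    (U : Matrix (Fin N) (Fin K) ℂ) (hU : U = Λ * B)
    (Um Up : Matrix (Fin (N - 1)) (Fin K) ℂ)
    (hUm : ∀ (j : Fin (N - 1)) (k : Fin K),
      Um j k = U ⟨(j : ℕ), by have := j.isLt; omega⟩ k)
    (hUp : ∀ (j : Fin (N - 1)) (k : Fin K),
      Up j k = U ⟨(j : ℕ) + 1, by have := j.isLt; omega⟩ k) :
    IsUnit (Umᴴ * Um) ∧
      (Umᴴ * Um)⁻¹ * Umᴴ * Up = B⁻¹ * Matrix.diagonal lam * B := by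
  have h1 : Um = Λm * B := by
    ext j k
    rw [hUm, hU, Matrix.mul_apply, Matrix.mul_apply]
    exact Finset.sum_congr rfl fun i _ => by rw [hΛm]
  have h2 : Up = Λm * Matrix.diagonal lam * B := by
    ext j k
    rw [hUp, hU, Matrix.mul_apply, Matrix.mul_apply]
    refine Finset.sum_congr rfl fun i _ => ?_
    rw [Matrix.mul_diagonal, hΛm, hΛ, hΛ, pow_succ]
  have hdet : IsUnit B.det := (Matrix.isUnit_iff_isUnit_det B).1 hB
  have hLinj : Function.Injective Λm.mulVec := Matrix.mulVec_injective_iff.2 hind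
  have hBinj : Function.Injective B.mulVec := Matrix.mulVec_injective_iff_isUnit.2 hB
  have hunit : IsUnit (Umᴴ * Um) := by
    open scoped ComplexOrder in
    rw [← Matrix.mulVec_injective_iff_isUnit]
    intro x y hxy
    have h3 : (Umᴴ * Um) *ᵥ (x - y) = 0 := by
      rw [Matrix.mulVec_sub]
      exact sub_eq_zero.2 hxy
    rw [Matrix.conjTranspose_mul_self_mulVec_eq_zero, Matrix.mulVec_sub, sub_eq_zero, h1,
      ← Matrix.mulVec_mulVec, ← Matrix.mulVec_mulVec] at h3
    exact hBinj (hLinj h3)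
  refine ⟨hunit, ?_⟩
  have h4 : Up = Um * (B⁻¹ * Matrix.diagonal lam * B) := by
    rw [h1, h2, Matrix.mul_assoc B⁻¹, Matrix.mul_assoc Λm B, Matrix.mul_nonsing_inv_cancel_left _ _ hdet,
      Matrix.mul_assoc]
  rw [h4, Matrix.mul_assoc, ← Matrix.mul_assoc Umᴴ,
    Matrix.nonsing_inv_mul_cancel_left _ _ ((Matrix.isUnit_iff_isUnit_det _).1 hunit)]
end

section
/- Let K, N be positive integers with N ≥ K+1, let λ_1,…,λ_K ∈ ℂ be pairwise distinct, let c_1,…,c_K ∈ ℂ be all nonzero, and let f : ℕ → ℂ be f(x) = Σ_{k=1}^K c_k λ_k^x. Let H be the N×N Hankel matrix H(m,n) = f(m+n), and let U be any N×K matrix whose columns form a basis of the column space of H. Then U_−^* U_− is invertible, and the characteristic polynomial of the K×K matrix A = (U_−^* U_−)^{−1} U_−^* U_+ equals ∏_{k=1}^K (X − λ_k); in particular the eigenvalues of A are exactly λ_1,…,λ_K. -/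
open Matrix Polynomial

/-- With `N ≥ K+1`, pairwise distinct `λ k`, nonzero `c k`,
`f(x) = ∑ k, c k * λ k ^ x`, `H` the N×N Hankel matrix of `f`, and `U` any N×K matrix whose
columns form a basis of the column space of `H`: the Gram matrix `U₋ᴴ U₋` is invertible and
the characteristic polynomial of `A = (U₋ᴴ U₋)⁻¹ U₋ᴴ U₊` equals `∏ k, (X - λ k)`;
in particular the eigenvalues of `A` are exactly `λ_1, …, λ_K`. -/
theorem esprit_charpoly
    (K N : ℕ) (hK : 0 < K) (hN : K + 1 ≤ N)
    (lam : Fin K → ℂ) (hdist : Function.Injective lam)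
    (c : Fin K → ℂ) (hc : ∀ k, c k ≠ 0)
    (f : ℕ → ℂ)
    (hf : ∀ x : ℕ, f x = ∑ k, c k * lam k ^ x)
    (H : Matrix (Fin N) (Fin N) ℂ)
    (hH : ∀ m n : Fin N, H m n = f ((m : ℕ) + (n : ℕ)))
    (U : Matrix (Fin N) (Fin K) ℂ)
    (hUind : LinearIndependent ℂ (fun k : Fin K => Uᵀ k))
    (hUspan : Submodule.span ℂ (Set.range Uᵀ) = LinearMap.range H.mulVecLin)
    (Um Up : Matrix (Fin (N - 1)) (Fin K) ℂ)
    (hUm : ∀ (j : Fin (N - 1)) (k : Fin K),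
      Um j k = U ⟨(j : ℕ), by have := j.isLt; omega⟩ k)
    (hUp : ∀ (j : Fin (N - 1)) (k : Fin K),
      Up j k = U ⟨(j : ℕ) + 1, by have := j.isLt; omega⟩ k)
    (A : Matrix (Fin K) (Fin K) ℂ)
    (hA : A = (Umᴴ * Um)⁻¹ * Umᴴ * Up) :
    IsUnit (Umᴴ * Um) ∧
      A.charpoly = ∏ k, (X - C (lam k)) ∧
      (∀ μ : ℂ, (∃ v : Fin K → ℂ, v ≠ 0 ∧ A.mulVec v = μ • v) ↔ ∃ k, μ = lam k) := by
  classical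
  set V : Matrix (Fin N) (Fin K) ℂ := Matrix.of fun m k => lam k ^ (m : ℕ) with hV
  set Vm : Matrix (Fin (N - 1)) (Fin K) ℂ := Matrix.of fun m k => lam k ^ (m : ℕ) with hVm
  -- the Hankel matrix factors through V
  have hHV : H = V * (Matrix.diagonal c * Vᵀ) := by
    ext m n
    rw [hH, hf, Matrix.mul_apply]
    refine Finset.sum_congr rfl fun k _ => ?_
    rw [Matrix.diagonal_mul]
    simp only [hV, Matrix.of_apply, Matrix.transpose_apply]
    ring
  have hcol : ∀ k, ∃ b : Fin K → ℂ, V *ᵥ b = Uᵀ k := by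
    intro k
    have h1 : Uᵀ k ∈ LinearMap.range H.mulVecLin := by
      rw [← hUspan]; exact Submodule.subset_span ⟨k, rfl⟩
    obtain ⟨x, hx⟩ := h1
    refine ⟨(Matrix.diagonal c * Vᵀ) *ᵥ x, ?_⟩
    rw [Matrix.mulVec_mulVec, ← hHV]
    exact hx
  choose b hb using hcol
  set B : Matrix (Fin K) (Fin K) ℂ := Matrix.of fun i k => b k i with hB
  have hUVB : U = V * B := by
    ext m k
    have := congrFun (hb k) m
    simp only [Matrix.transpose_apply] at this
    rw [← this]; rfl
  have hUinj : Function.Injective U.mulVec := Matrix.mulVec_injective_iff.2 hUind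
  have hBunit : IsUnit B := by
    rw [← Matrix.mulVec_injective_iff_isUnit]
    intro x y hxy
    apply hUinj
    change B *ᵥ x = B *ᵥ y at hxy
    change U *ᵥ x = U *ᵥ y
    rw [hUVB, ← Matrix.mulVec_mulVec, ← Matrix.mulVec_mulVec, hxy]
  have hVminj : ∀ v, Vm *ᵥ v = 0 → v = 0 := by
    intro v hv
    refine Matrix.eq_zero_of_mulVec_eq_zero (M := (Matrix.vandermonde lam)ᵀ) ?_ ?_
    · rw [Matrix.det_transpose]
      exact Matrix.det_vandermonde_ne_zero_iff.2 hdist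
    · ext i
      exact congrFun hv ⟨i, by have := i.isLt; omega⟩
  have hUmV : Um = Vm * B := by
    ext j k
    rw [hUm, hUVB]; rfl
  have hUpV : Up = Vm * (Matrix.diagonal lam * B) := by
    ext j k
    rw [hUp, hUVB, Matrix.mul_apply, Matrix.mul_apply]
    refine Finset.sum_congr rfl fun i _ => ?_
    rw [Matrix.diagonal_mul]
    simp only [hV, hVm, Matrix.of_apply]
    ring
  have hBdet : IsUnit B.det := (Matrix.isUnit_iff_isUnit_det _).1 hBunit
  have hG : IsUnit (Umᴴ * Um) := by
    rw [Matrix.isUnit_iff_isUnit_det, isUnit_iff_ne_zero]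
    intro h0
    obtain ⟨v, hv0, hv⟩ := Matrix.exists_mulVec_eq_zero_iff.2 h0
    open scoped ComplexOrder in
    rw [Matrix.conjTranspose_mul_self_mulVec_eq_zero, hUmV, ← Matrix.mulVec_mulVec] at hv
    exact hv0 (Matrix.eq_zero_of_mulVec_eq_zero hBdet.ne_zero (hVminj _ hv))
  have hGdet : IsUnit (Umᴴ * Um).det := (Matrix.isUnit_iff_isUnit_det _).1 hG
  have hUpUm : Up = Um * (B⁻¹ * Matrix.diagonal lam * B) := by
    rw [hUpV, hUmV, Matrix.mul_assoc, Matrix.mul_assoc, Matrix.mul_nonsing_inv_cancel_left _ _ hBdet]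
  have hAB : A = B⁻¹ * Matrix.diagonal lam * B := by
    rw [hA, Matrix.mul_assoc, hUpUm, ← Matrix.mul_assoc Umᴴ, Matrix.nonsing_inv_mul_cancel_left _ _ hGdet]
  have hBA : B * A = Matrix.diagonal lam * B := by
    rw [hAB, Matrix.mul_assoc, Matrix.mul_nonsing_inv_cancel_left _ _ hBdet]
  refine ⟨hG, ?_, ?_⟩
  · have := Matrix.charpoly_units_conj' hBunit.unit (Matrix.diagonal lam)
    rw [IsUnit.unit_spec, ← hAB] at this
    rw [this, Matrix.charpoly_diagonal]
  · intro μ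
    constructor
    · rintro ⟨v, hv0, hv⟩
      have hw : B *ᵥ v ≠ 0 := fun h => hv0 (Matrix.eq_zero_of_mulVec_eq_zero hBdet.ne_zero h)
      obtain ⟨k, hk⟩ := Function.ne_iff.1 hw
      refine ⟨k, ?_⟩
      have h1 : Matrix.diagonal lam *ᵥ (B *ᵥ v) = μ • (B *ᵥ v) := by
        rw [Matrix.mulVec_mulVec, ← hBA, ← Matrix.mulVec_mulVec, hv, Matrix.mulVec_smul]
      have h2 := congrFun h1 k
      rw [Matrix.mulVec_diagonal, Pi.smul_apply, smul_eq_mul] at h2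
      exact (mul_right_cancel₀ hk h2).symm
    · rintro ⟨k, rfl⟩
      refine ⟨B⁻¹ *ᵥ Pi.single k 1, ?_, ?_⟩
      · intro h
        have h1 : B *ᵥ (B⁻¹ *ᵥ Pi.single k 1) = 0 := by rw [h, Matrix.mulVec_zero]
        rw [Matrix.mulVec_mulVec, Matrix.mul_nonsing_inv _ hBdet, Matrix.one_mulVec] at h1
        simpa using congrFun h1 k
      · rw [Matrix.mulVec_mulVec, hAB, Matrix.mul_assoc, Matrix.mul_nonsing_inv _ hBdet,
          Matrix.mul_one, ← Matrix.mulVec_mulVec, ← Matrix.mulVec_smul]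
        congr 1
        ext i
        rw [Matrix.mulVec_diagonal]
        by_cases h : i = k
        · subst h; simp
        · simp [h]
end

section
/- Let d, K, N be positive integers, let λ_1,…,λ_K ∈ ℂ^d, let c_1,…,c_K ∈ ℂ be all nonzero, and let f : ℕ^d → ℂ be f(x) = Σ_{k=1}^K c_k ∏_{p=1}^d λ_{k,p}^{x_p}. If the K columns of the multivariate Vandermonde matrix 𝚲 with entries 𝚲(m,k) = ∏_{p=1}^d λ_{k,p}^{m_p}, m ∈ {0,…,N−1}^d, are linearly independent, then the block Hankel matrix H with entries H(m,n) = f(m+n), m, n ∈ {0,…,N−1}^d, has rank exactly K. -/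
open Matrix

/-- If the columns of the multivariate Vandermonde matrix `𝚲` are linearly
independent and the `c k` are all nonzero, then the d-dimensional block Hankel matrix of
`f(x) = ∑ k, c k * ∏ p, λ k p ^ x p` has rank exactly `K`. -/
theorem block_hankel_rank_eq
    (d K N : ℕ) (hd : 0 < d) (hK : 0 < K) (hN : 0 < N)
    (lam : Fin K → Fin d → ℂ)
    (c : Fin K → ℂ) (hc : ∀ k, c k ≠ 0)
    (f : (Fin d → ℕ) → ℂ)
    (hf : ∀ x : Fin d → ℕ, f x = ∑ k, c k * ∏ p, lam k p ^ x p)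
    (Λ : Matrix (Fin d → Fin N) (Fin K) ℂ)
    (hΛ : ∀ (m : Fin d → Fin N) (k : Fin K), Λ m k = ∏ p, lam k p ^ (m p : ℕ))
    (hind : LinearIndependent ℂ (fun k : Fin K => Λᵀ k))
    (H : Matrix (Fin d → Fin N) (Fin d → Fin N) ℂ)
    (hH : ∀ m n : Fin d → Fin N, H m n = f (fun p => (m p : ℕ) + (n p : ℕ))) :
    H.rank = K := by
  have hfac : H = Λ * (diagonal c * Λᵀ) := by
    ext m n
    rw [hH, hf, Matrix.mul_apply]
    refine Finset.sum_congr rfl fun k _ => ?_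
    rw [diagonal_mul, transpose_apply, hΛ, hΛ]
    simp only [pow_add, Finset.prod_mul_distrib]
    ring
  have hinj : Function.Injective Λ.mulVecLin := by
    have := Matrix.mulVec_injective_iff.mpr (show LinearIndependent ℂ Λ.col from hind)
    exact this
  have hdet : (diagonal c).det ≠ 0 := by
    rw [det_diagonal]
    exact Finset.prod_ne_zero_iff.mpr fun k _ => hc k
  have h1 : (Λ * (diagonal c * Λᵀ)).rank = (diagonal c * Λᵀ).rank := by
    rw [rank, rank, mulVecLin_mul, LinearMap.range_comp]
    exact (Submodule.equivMapOfInjective _ hinj _).symm.finrank_eq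
  rw [hfac, h1, rank_mul_eq_right_of_det_ne_zero _ _ hdet]
  have h2 := LinearIndependent.rank_matrix (M := Λᵀ) hind
  simpa using h2
end

section
/- Let d, K, N be positive integers with N ≥ 2, let λ_1,…,λ_K ∈ ℂ^d, and let 𝚲 be the {0,…,N−1}^d × K multivariate Vandermonde matrix with 𝚲(m,k) = ∏_{p=1}^d λ_{k,p}^{m_p}. Assume that for every p ∈ {1,…,d} the columns of 𝚲_{p−} (the submatrix of 𝚲 consisting of rows m with m_p ≤ N−2) are linearly independent. Let B be an invertible K×K matrix and set 𝐔 = 𝚲 B. Then for every p ∈ {1,…,d}, the matrix 𝐔_{p−}^* 𝐔_{p−} is invertible and A_p := (𝐔_{p−}^* 𝐔_{p−})^{−1} 𝐔_{p−}^* 𝐔_{p+} = B^{−1} D_p B, where D_p = diag(λ_{1,p},…,λ_{K,p}); in particular the single matrix B^{−1} simultaneously diagonalizes all the matrices A_1,…,A_d. -/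
open Matrix

/-- Assume for every `p` that the columns of `𝚲_{p−}` are linearly
independent, let `B` be invertible and `𝐔 = 𝚲 * B`. Then for every `p` the Gram matrix
`𝐔_{p−}ᴴ 𝐔_{p−}` is invertible and
`A_p = (𝐔_{p−}ᴴ 𝐔_{p−})⁻¹ 𝐔_{p−}ᴴ 𝐔_{p+} = B⁻¹ D_p B` with `D_p = diag(λ_{1,p},…,λ_{K,p})`;
in particular the single matrix `B⁻¹` simultaneously diagonalizes all the `A_p`. -/
theorem multidim_esprit_rotation_identity
    (d K N : ℕ) (hd : 0 < d) (hK : 0 < K) (hN : 2 ≤ N)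
    (lam : Fin K → Fin d → ℂ)
    (Λ : Matrix (Fin d → Fin N) (Fin K) ℂ)
    (hΛ : ∀ (m : Fin d → Fin N) (k : Fin K), Λ m k = ∏ q, lam k q ^ (m q : ℕ))
    (Λm : ∀ p : Fin d, Matrix {m : Fin d → Fin N // (m p : ℕ) + 1 < N} (Fin K) ℂ)
    (hΛm : ∀ (p : Fin d) (m : {m : Fin d → Fin N // (m p : ℕ) + 1 < N}) (k : Fin K),
      Λm p m k = Λ m.1 k)
    (hind : ∀ p : Fin d, LinearIndependent ℂ (fun k : Fin K => (Λm p)ᵀ k))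
    (B : Matrix (Fin K) (Fin K) ℂ) (hB : IsUnit B)
    (U : Matrix (Fin d → Fin N) (Fin K) ℂ) (hU : U = Λ * B)
    (Um Up : ∀ p : Fin d, Matrix {m : Fin d → Fin N // (m p : ℕ) + 1 < N} (Fin K) ℂ)
    (hUm : ∀ (p : Fin d) (m : {m : Fin d → Fin N // (m p : ℕ) + 1 < N}) (k : Fin K),
      Um p m k = U m.1 k)
    (hUp : ∀ (p : Fin d) (m : {m : Fin d → Fin N // (m p : ℕ) + 1 < N}) (k : Fin K),
      Up p m k = U (Function.update m.1 p ⟨(m.1 p : ℕ) + 1, m.2⟩) k) :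
    ∀ p : Fin d,
      IsUnit ((Um p)ᴴ * Um p) ∧
      ((Um p)ᴴ * Um p)⁻¹ * (Um p)ᴴ * Up p
        = B⁻¹ * Matrix.diagonal (fun k => lam k p) * B := by
  intro p
  have hUmB : Um p = Λm p * B := by
    ext m k
    rw [hUm, hU, Matrix.mul_apply, Matrix.mul_apply]
    simp only [hΛm]
  have hUpB : Up p = Λm p * Matrix.diagonal (fun k => lam k p) * B := by
    ext m k
    rw [hUp, hU, Matrix.mul_apply, Matrix.mul_apply]
    refine Finset.sum_congr rfl fun j _ => ?_
    rw [Matrix.mul_diagonal, hΛm, hΛ, hΛ]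
    congr 1
    rw [← Finset.mul_prod_erase Finset.univ _ (Finset.mem_univ p),
      ← Finset.mul_prod_erase Finset.univ (fun q => lam j q ^ (m.1 q : ℕ)) (Finset.mem_univ p)]
    have h : ∏ q ∈ Finset.univ.erase p,
        lam j q ^ (Function.update m.1 p ⟨(m.1 p : ℕ) + 1, m.2⟩ q : ℕ)
        = ∏ q ∈ Finset.univ.erase p, lam j q ^ (m.1 q : ℕ) := by
      refine Finset.prod_congr rfl fun q hq => ?_
      rw [Function.update_of_ne (Finset.ne_of_mem_erase hq)]
    rw [h, Function.update_self]
    simp only [pow_succ]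
    ring
  have hinjL : Function.Injective (Λm p).mulVec := Matrix.mulVec_injective_iff.2 (hind p)
  have hinjB : Function.Injective B.mulVec := Matrix.mulVec_injective_iff_isUnit.2 hB
  have hunit : IsUnit ((Um p)ᴴ * Um p) := by
    rw [← Matrix.mulVec_injective_iff_isUnit]
    have h0 : ∀ v, ((Um p)ᴴ * Um p) *ᵥ v = 0 → v = 0 := by
      intro v hv
      open scoped ComplexOrder in
      rw [Matrix.conjTranspose_mul_self_mulVec_eq_zero, hUmB, ← Matrix.mulVec_mulVec] at hv
      apply hinjB
      apply hinjL
      simpa using hv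
    intro v w hvw
    apply sub_eq_zero.1
    apply h0
    rw [Matrix.mulVec_sub]
    exact sub_eq_zero.2 hvw
  refine ⟨hunit, ?_⟩
  have hBd : IsUnit B.det := (Matrix.isUnit_iff_isUnit_det B).1 hB
  have hGd := (Matrix.isUnit_iff_isUnit_det _).1 hunit
  have hUpU : Up p = Um p * (B⁻¹ * Matrix.diagonal (fun k => lam k p) * B) := by
    rw [hUpB, hUmB]
    simp only [Matrix.mul_assoc]
    rw [Matrix.mul_nonsing_inv_cancel_left _ _ hBd]
  rw [hUpU, Matrix.mul_assoc, ← Matrix.mul_assoc (Um p)ᴴ,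
    Matrix.nonsing_inv_mul_cancel_left _ _ hGd]
end

section
/- Let d, K, N be positive integers with N ≥ 2, let λ_1,…,λ_K ∈ ℂ^d, let c_1,…,c_K ∈ ℂ be all nonzero, and let f : ℕ^d → ℂ be f(x) = Σ_{k=1}^K c_k ∏_{p=1}^d λ_{k,p}^{x_p}. Let 𝚲 be the {0,…,N−1}^d × K multivariate Vandermonde matrix 𝚲(m,k) = ∏_p λ_{k,p}^{m_p}, and assume that for every p ∈ {1,…,d} the columns of 𝚲_{p−} are linearly independent. Let H be the block Hankel matrix H(m,n) = f(m+n), m,n ∈ {0,…,N−1}^d, and let 𝐔 be any matrix whose columns form a basis of the column space of H. Then there exists an invertible K×K matrix B such that, for all p ∈ {1,…,d}, the matrix A_p := (𝐔_{p−}^* 𝐔_{p−})^{−1} 𝐔_{p−}^* 𝐔_{p+} satisfies B A_p B^{−1} = diag(λ_{1,p},…,λ_{K,p}); in particular, for each k the d-tuple (λ_{k,1},…,λ_{k,d}) is recovered as the k-th diagonal entries of B A_1 B^{−1},…, B A_d B^{−1}, with the pairing across dimensions determined by the common matrix B. -/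
open Matrix

/-- For `f(x) = ∑ k, c k * ∏ p, λ k p ^ x p` with nonzero `c k`, assuming
the columns of every `𝚲_{p−}` are linearly independent, and letting `𝐔` be any matrix
whose columns form a basis of the column space of the block Hankel matrix `H`, there is a
single invertible matrix `B` such that for all `p`,
`A_p = (𝐔_{p−}ᴴ 𝐔_{p−})⁻¹ 𝐔_{p−}ᴴ 𝐔_{p+}` satisfies
`B * A_p * B⁻¹ = diag(λ_{1,p},…,λ_{K,p})`; in particular each multi-frequency
`(λ_{k,1},…,λ_{k,d})` is recovered, correctly paired, as the k-th diagonal entries. -/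
theorem multidim_esprit_recovery
    (d K N : ℕ) (hd : 0 < d) (hK : 0 < K) (hN : 2 ≤ N)
    (lam : Fin K → Fin d → ℂ)
    (c : Fin K → ℂ) (hc : ∀ k, c k ≠ 0)
    (f : (Fin d → ℕ) → ℂ)
    (hf : ∀ x : Fin d → ℕ, f x = ∑ k, c k * ∏ p, lam k p ^ x p)
    (Λ : Matrix (Fin d → Fin N) (Fin K) ℂ)
    (hΛ : ∀ (m : Fin d → Fin N) (k : Fin K), Λ m k = ∏ q, lam k q ^ (m q : ℕ))
    (Λm : ∀ p : Fin d, Matrix {m : Fin d → Fin N // (m p : ℕ) + 1 < N} (Fin K) ℂ)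
    (hΛm : ∀ (p : Fin d) (m : {m : Fin d → Fin N // (m p : ℕ) + 1 < N}) (k : Fin K),
      Λm p m k = Λ m.1 k)
    (hind : ∀ p : Fin d, LinearIndependent ℂ (fun k : Fin K => (Λm p)ᵀ k))
    (H : Matrix (Fin d → Fin N) (Fin d → Fin N) ℂ)
    (hH : ∀ m n : Fin d → Fin N, H m n = f (fun p => (m p : ℕ) + (n p : ℕ)))
    (U : Matrix (Fin d → Fin N) (Fin K) ℂ)
    (hUind : LinearIndependent ℂ (fun k : Fin K => Uᵀ k))
    (hUspan : Submodule.span ℂ (Set.range Uᵀ) = LinearMap.range H.mulVecLin)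
    (Um Up : ∀ p : Fin d, Matrix {m : Fin d → Fin N // (m p : ℕ) + 1 < N} (Fin K) ℂ)
    (hUm : ∀ (p : Fin d) (m : {m : Fin d → Fin N // (m p : ℕ) + 1 < N}) (k : Fin K),
      Um p m k = U m.1 k)
    (hUp : ∀ (p : Fin d) (m : {m : Fin d → Fin N // (m p : ℕ) + 1 < N}) (k : Fin K),
      Up p m k = U (Function.update m.1 p ⟨(m.1 p : ℕ) + 1, m.2⟩) k) :
    ∃ B : Matrix (Fin K) (Fin K) ℂ, IsUnit B ∧
      ∀ p : Fin d,
        IsUnit ((Um p)ᴴ * Um p) ∧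
        B * (((Um p)ᴴ * Um p)⁻¹ * (Um p)ᴴ * Up p) * B⁻¹
          = Matrix.diagonal (fun k => lam k p) := by
  have hex : ∀ k : Fin K, ∃ v : (Fin d → Fin N) → ℂ, H *ᵥ v = Uᵀ k := by
    intro k
    have h1 : Uᵀ k ∈ Submodule.span ℂ (Set.range Uᵀ) := Submodule.subset_span ⟨k, rfl⟩
    rw [hUspan] at h1
    obtain ⟨v, hv⟩ := h1
    exact ⟨v, hv⟩
  choose v hv using hex
  obtain ⟨G, hG⟩ : ∃ G : Matrix (Fin K) (Fin K) ℂ, U = Λ * G := by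
    refine ⟨Matrix.of fun i k => c i * ∑ n, Λ n i * v k n, ?_⟩
    ext m k
    have h1 : U m k = (H *ᵥ v k) m := by rw [hv k]; rfl
    rw [h1, Matrix.mul_apply]
    simp only [Matrix.mulVec, dotProduct, Matrix.of_apply, hH, hf, hΛ, Finset.sum_mul,
      Finset.mul_sum, pow_add, Finset.prod_mul_distrib]
    rw [Finset.sum_comm]
    refine Finset.sum_congr rfl fun i _ => Finset.sum_congr rfl fun n _ => ?_
    ring
  have hUinj : Function.Injective U.mulVec := Matrix.mulVec_injective_iff.2 hUind
  have hGinj : Function.Injective G.mulVec := by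
    intro x y hxy
    apply hUinj
    rw [hG, ← Matrix.mulVec_mulVec, ← Matrix.mulVec_mulVec]
    exact congrArg _ hxy
  have hGu : IsUnit G := Matrix.mulVec_injective_iff_isUnit.1 hGinj
  have hGdet : IsUnit G.det := (Matrix.isUnit_iff_isUnit_det G).1 hGu
  refine ⟨G, hGu, fun p => ?_⟩
  have hUmG : Um p = Λm p * G := by
    ext m k
    rw [hUm, hG, Matrix.mul_apply, Matrix.mul_apply]
    simp only [hΛm]
  have hUpG : Up p = Λm p * Matrix.diagonal (fun k => lam k p) * G := by
    ext m k
    rw [hUp, hG, Matrix.mul_apply, Matrix.mul_apply]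
    refine Finset.sum_congr rfl fun i _ => ?_
    rw [Matrix.mul_diagonal, hΛm, hΛ, hΛ]
    congr 1
    rw [← Finset.mul_prod_erase _ _ (Finset.mem_univ p),
      ← Finset.mul_prod_erase Finset.univ (fun q => lam i q ^ ((m.1 q : Fin N) : ℕ))
        (Finset.mem_univ p)]
    have h2 : ∏ x ∈ Finset.univ.erase p, lam i x ^
        ((Function.update m.1 p ⟨(m.1 p : ℕ) + 1, m.2⟩ x : Fin N) : ℕ)
        = ∏ x ∈ Finset.univ.erase p, lam i x ^ ((m.1 x : Fin N) : ℕ) := by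
      refine Finset.prod_congr rfl fun x hx => ?_
      rw [Function.update_of_ne (Finset.ne_of_mem_erase hx)]
    rw [h2, Function.update_self]
    simp only [pow_succ]
    ring
  have hLinj : Function.Injective (Λm p).mulVec := Matrix.mulVec_injective_iff.2 (hind p)
  have hUminj : Function.Injective (Um p).mulVec := by
    intro x y hxy
    rw [hUmG, ← Matrix.mulVec_mulVec, ← Matrix.mulVec_mulVec] at hxy
    exact hGinj (hLinj hxy)
  have hu : IsUnit ((Um p)ᴴ * Um p) := by
    rw [← Matrix.mulVec_injective_iff_isUnit]
    intro x y hxy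
    have h0 : ((Um p)ᴴ * Um p) *ᵥ (x - y) = 0 := by
      rw [Matrix.mulVec_sub]; exact sub_eq_zero.2 hxy
    open scoped ComplexOrder in
    rw [Matrix.conjTranspose_mul_self_mulVec_eq_zero, Matrix.mulVec_sub] at h0
    exact hUminj (sub_eq_zero.1 h0)
  refine ⟨hu, ?_⟩
  have hdet := (Matrix.isUnit_iff_isUnit_det _).1 hu
  have hL : Λm p = Um p * G⁻¹ := by
    rw [hUmG, Matrix.mul_assoc, Matrix.mul_nonsing_inv _ hGdet, Matrix.mul_one]
  have hA : ((Um p)ᴴ * Um p)⁻¹ * (Um p)ᴴ * Up p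
      = G⁻¹ * Matrix.diagonal (fun k => lam k p) * G := by
    have h3 : Up p = Um p * (G⁻¹ * Matrix.diagonal (fun k => lam k p) * G) := by
      rw [hUpG, hL]; simp only [Matrix.mul_assoc]
    rw [h3, Matrix.mul_assoc, ← Matrix.mul_assoc (Um p)ᴴ, ← Matrix.mul_assoc,
      Matrix.nonsing_inv_mul _ hdet, Matrix.one_mul]
  rw [hA, Matrix.mul_assoc, Matrix.mul_assoc, Matrix.mul_nonsing_inv _ hGdet, Matrix.mul_one,
    ← Matrix.mul_assoc, Matrix.mul_nonsing_inv _ hGdet, Matrix.one_mul]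
end

section
/- Let d be a positive integer, let Ξ and Υ be finite nonempty subsets of ℤ^d, let λ_1,…,λ_K ∈ (ℂ∖{0})^d, let c_1,…,c_K ∈ ℂ be all nonzero, and let f : ℤ^d → ℂ be f(x) = Σ_{k=1}^K c_k λ_k^x. If the vectors Λ_Ξ(λ_1),…,Λ_Ξ(λ_K) ∈ ℂ^Ξ are linearly independent and the vectors Λ_Υ(λ_1),…,Λ_Υ(λ_K) ∈ ℂ^Υ are linearly independent, then the general domain Hankel matrix H_{f,Υ,Ξ} has rank exactly K. -/
open Matrix

/-- If moreover the `c k` are nonzero and the vectors `Λ_Ξ(λ_k)` are linearly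
independent in `ℂ^Ξ` and the vectors `Λ_Υ(λ_k)` are linearly independent in `ℂ^Υ`, then the
general domain Hankel matrix `H_{f,Υ,Ξ}` has rank exactly `K`. -/
theorem general_domain_hankel_rank_eq
    (d K : ℕ) (hd : 0 < d)
    (Ξ Υ : Finset (Fin d → ℤ)) (hΞ : Ξ.Nonempty) (hΥ : Υ.Nonempty)
    (lam : Fin K → Fin d → ℂ) (hlam : ∀ k p, lam k p ≠ 0)
    (c : Fin K → ℂ) (hc : ∀ k, c k ≠ 0)
    (f : (Fin d → ℤ) → ℂ)
    (hf : ∀ x : Fin d → ℤ, f x = ∑ k, c k * ∏ p, lam k p ^ x p)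
    (hindΞ : LinearIndependent ℂ
      (fun k : Fin K => fun n : Ξ => ∏ p, lam k p ^ ((n : Fin d → ℤ) p)))
    (hindΥ : LinearIndependent ℂ
      (fun k : Fin K => fun m : Υ => ∏ p, lam k p ^ ((m : Fin d → ℤ) p)))
    (H : Matrix Ξ Υ ℂ)
    (hH : ∀ (n : Ξ) (m : Υ), H n m = f ((n : Fin d → ℤ) + (m : Fin d → ℤ))) :
    H.rank = K := by
  set A : Matrix (Fin K) Ξ ℂ :=
    Matrix.of (fun k : Fin K => fun n : Ξ => ∏ p, lam k p ^ ((n : Fin d → ℤ) p)) with hA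
  set B : Matrix (Fin K) Υ ℂ :=
    Matrix.of (fun k : Fin K => fun m : Υ => c k * ∏ p, lam k p ^ ((m : Fin d → ℤ) p)) with hB
  have hHAB : H = Aᵀ * B := by
    ext n m
    rw [hH, hf, Matrix.mul_apply]
    refine Finset.sum_congr rfl fun k _ => ?_
    have h : ∏ p, lam k p ^ (((n : Fin d → ℤ) + (m : Fin d → ℤ)) p)
        = (∏ p, lam k p ^ ((n : Fin d → ℤ) p)) * ∏ p, lam k p ^ ((m : Fin d → ℤ) p) := by
      rw [← Finset.prod_mul_distrib]
      exact Finset.prod_congr rfl fun p _ => zpow_add₀ (hlam k p) _ _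
    rw [h]
    simp only [hA, hB, Matrix.transpose_apply, Matrix.of_apply]
    ring
  have hBrank : B.rank = K := by
    have hBi : LinearIndependent ℂ B.row :=
      hindΥ.units_smul (fun k => Units.mk0 (c k) (hc k))
    simpa using hBi.rank_matrix
  have hAinj : Function.Injective Aᵀ.mulVecLin := by
    have : Function.Injective Aᵀ.mulVec := by
      rw [Matrix.mulVec_injective_iff]
      exact hindΞ
    exact this
  refine Eq.trans ?_ hBrank
  rw [hHAB, Matrix.rank, Matrix.rank, Matrix.mulVecLin_mul, LinearMap.range_comp]
  exact (Submodule.equivMapOfInjective _ hAinj _).finrank_eq.symm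
end

section
/- Let d be a positive integer, let Ξ and Υ be finite nonempty subsets of ℤ^d, let λ_1,…,λ_K ∈ (ℂ∖{0})^d, let c_1,…,c_K ∈ ℂ be all nonzero, and let f : ℤ^d → ℂ be f(x) = Σ_{k=1}^K c_k λ_k^x. If the vectors Λ_Υ(λ_1),…,Λ_Υ(λ_K) ∈ ℂ^Υ are linearly independent, then the column space of the general domain Hankel matrix H_{f,Υ,Ξ} equals the linear span of the vectors Λ_Ξ(λ_1),…,Λ_Ξ(λ_K) in ℂ^Ξ. -/
open Matrix

/-- If the vectors `Λ_Υ(λ_k)` are linearly independent in `ℂ^Υ` and the `c k`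
are nonzero, then the column space of the general domain Hankel matrix `H_{f,Υ,Ξ}` equals
the span of the vectors `Λ_Ξ(λ_1), …, Λ_Ξ(λ_K)` in `ℂ^Ξ`. -/
theorem general_domain_hankel_column_space
    (d K : ℕ) (hd : 0 < d)
    (Ξ Υ : Finset (Fin d → ℤ)) (hΞ : Ξ.Nonempty) (hΥ : Υ.Nonempty)
    (lam : Fin K → Fin d → ℂ) (hlam : ∀ k p, lam k p ≠ 0)
    (c : Fin K → ℂ) (hc : ∀ k, c k ≠ 0)
    (f : (Fin d → ℤ) → ℂ)
    (hf : ∀ x : Fin d → ℤ, f x = ∑ k, c k * ∏ p, lam k p ^ x p)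
    (hindΥ : LinearIndependent ℂ
      (fun k : Fin K => fun m : Υ => ∏ p, lam k p ^ ((m : Fin d → ℤ) p)))
    (H : Matrix Ξ Υ ℂ)
    (hH : ∀ (n : Ξ) (m : Υ), H n m = f ((n : Fin d → ℤ) + (m : Fin d → ℤ))) :
    LinearMap.range H.mulVecLin
      = Submodule.span ℂ
          (Set.range fun k : Fin K => fun n : Ξ => ∏ p, lam k p ^ ((n : Fin d → ℤ) p)) := by
  have key : ∀ v : Υ → ℂ, H.mulVecLin v = ∑ k, (c k * ∑ m : Υ, v m * ∏ p, lam k p ^ ((m : Fin d → ℤ) p)) •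
      (fun n : Ξ => ∏ p, lam k p ^ ((n : Fin d → ℤ) p)) := by
    intro v
    ext n
    simp only [Matrix.mulVecLin_apply, Matrix.mulVec, dotProduct, Finset.sum_apply, Pi.smul_apply,
      smul_eq_mul, hH, hf, Finset.sum_mul, Finset.mul_sum]
    rw [Finset.sum_comm]
    refine Finset.sum_congr rfl fun k _ => Finset.sum_congr rfl fun m _ => ?_
    have : ∏ p, lam k p ^ (((n : Fin d → ℤ) + (m : Fin d → ℤ)) p)
        = (∏ p, lam k p ^ ((n : Fin d → ℤ) p)) * ∏ p, lam k p ^ ((m : Fin d → ℤ) p) := by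
      rw [← Finset.prod_mul_distrib]
      exact Finset.prod_congr rfl fun p _ => zpow_add₀ (hlam k p) _ _
    rw [this]
    ring
  apply le_antisymm
  · rintro _ ⟨v, rfl⟩
    rw [key]
    exact Submodule.sum_mem _ fun k _ =>
      Submodule.smul_mem _ _ (Submodule.subset_span ⟨k, rfl⟩)
  · rw [Submodule.span_le]
    rintro _ ⟨k, rfl⟩
    obtain ⟨L, hL⟩ := LinearMap.exists_leftInverse_of_injective _
      (LinearMap.ker_eq_bot.2 (linearIndependent_iff_injective_fintypeLinearCombination.1 hindΥ))
    have hφ : ∀ j : Fin K, (∑ m : Υ, L (Pi.single m 1) k * ∏ p, lam j p ^ ((m : Fin d → ℤ) p))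
        = if j = k then 1 else 0 := by
      intro j
      have h1 := congrFun (LinearMap.congr_fun hL (Pi.single j 1)) k
      simp only [LinearMap.comp_apply, LinearMap.id_apply,
        Fintype.linearCombination_apply_single, one_smul] at h1
      rw [LinearMap.pi_apply_eq_sum_univ L] at h1
      simp only [Finset.sum_apply, Pi.smul_apply, smul_eq_mul, Pi.single_apply] at h1
      rw [show (if j = k then (1 : ℂ) else 0) = if k = j then 1 else 0 by simp [eq_comm], ← h1]
      refine Finset.sum_congr rfl fun m _ => ?_
      have h2 : (Pi.single m 1 : Υ → ℂ) = fun i => if m = i then 1 else 0 := by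
        ext i
        simp [Pi.single_apply, eq_comm]
      rw [mul_comm, h2]
    refine ⟨(c k)⁻¹ • fun m => L (Pi.single m 1) k, ?_⟩
    rw [map_smul, key]
    simp only [hφ]
    simp [smul_smul, hc k]
end

section
/- Let d be a positive integer, let Ξ be a finite nonempty subset of ℤ^d, let λ_1,…,λ_K ∈ (ℂ∖{0})^d, and let 𝚲 be the Ξ×K matrix with entries 𝚲(j,k) = λ_k^j. Fix p ∈ {1,…,d}, let Ξ_{−,p} = {j ∈ Ξ : j + e_p ∈ Ξ}, and assume the columns of 𝚲_{−,p} (the submatrix of 𝚲 with rows restricted to Ξ_{−,p}) are linearly independent. Let B be an invertible K×K matrix and set 𝐔 = 𝚲 B. Then 𝐔_{−,p}^* 𝐔_{−,p} is invertible and (𝐔_{−,p}^* 𝐔_{−,p})^{−1} 𝐔_{−,p}^* 𝐔_{+,p} = B^{−1} D_p B, where D_p = diag(λ_{1,p},…,λ_{K,p}), 𝐔_{−,p} is the submatrix of 𝐔 with rows restricted to Ξ_{−,p}, and 𝐔_{+,p} is the Ξ_{−,p}×K matrix whose row at index j is the row of 𝐔 at index j + e_p. -/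
open Matrix

/-- General domain ESPRIT rotation identity. Let `Ξ ⊂ ℤ^d` be finite and
nonempty, `𝚲(j,k) = λ_k^j` the `Ξ×K` Vandermonde-type matrix, `p` a fixed coordinate, and
`Ξ_{−,p} = {j ∈ Ξ : j + e_p ∈ Ξ}`. If the columns of `𝚲_{−,p}` are linearly independent,
`B` is invertible and `𝐔 = 𝚲 B`, then `𝐔_{−,p}ᴴ 𝐔_{−,p}` is invertible and
`(𝐔_{−,p}ᴴ 𝐔_{−,p})⁻¹ 𝐔_{−,p}ᴴ 𝐔_{+,p} = B⁻¹ D_p B` with `D_p = diag(λ_{1,p},…,λ_{K,p})`. -/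
theorem general_domain_esprit_rotation_identity
    (d K : ℕ) (hd : 0 < d)
    (Ξ : Finset (Fin d → ℤ)) (hΞ : Ξ.Nonempty)
    (lam : Fin K → Fin d → ℂ) (hlam : ∀ k q, lam k q ≠ 0)
    (Λ : Matrix Ξ (Fin K) ℂ)
    (hΛ : ∀ (j : Ξ) (k : Fin K), Λ j k = ∏ q, lam k q ^ ((j : Fin d → ℤ) q))
    (p : Fin d)
    (Ξm : Finset (Fin d → ℤ))
    (hΞm : Ξm = Ξ.filter (fun j => j + Pi.single p 1 ∈ Ξ))
    (hind : LinearIndependent ℂ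
      (fun k : Fin K => fun j : Ξm => ∏ q, lam k q ^ ((j : Fin d → ℤ) q)))
    (B : Matrix (Fin K) (Fin K) ℂ) (hB : IsUnit B)
    (U : Matrix Ξ (Fin K) ℂ) (hU : U = Λ * B)
    (Um Up : Matrix Ξm (Fin K) ℂ)
    (hUm : ∀ (j : Ξm) (hj : (j : Fin d → ℤ) ∈ Ξ) (k : Fin K),
      Um j k = U ⟨(j : Fin d → ℤ), hj⟩ k)
    (hUp : ∀ (j : Ξm) (hj : (j : Fin d → ℤ) + Pi.single p 1 ∈ Ξ) (k : Fin K),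
      Up j k = U ⟨(j : Fin d → ℤ) + Pi.single p 1, hj⟩ k) :
    IsUnit (Umᴴ * Um) ∧
      (Umᴴ * Um)⁻¹ * Umᴴ * Up = B⁻¹ * Matrix.diagonal (fun k => lam k p) * B := by
  classical
  have hmem : ∀ j : Ξm, (j : Fin d → ℤ) ∈ Ξ ∧ (j : Fin d → ℤ) + Pi.single p 1 ∈ Ξ := by
    rintro ⟨j, h⟩
    rw [hΞm] at h
    simpa using h
  let L : Matrix Ξm (Fin K) ℂ := fun j k => ∏ q, lam k q ^ ((j : Fin d → ℤ) q)
  have hBdet : IsUnit B.det := (Matrix.isUnit_iff_isUnit_det B).1 hB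
  have h1 : Um = L * B := by
    ext j k
    rw [hUm j (hmem j).1 k, hU, Matrix.mul_apply, Matrix.mul_apply]
    refine Finset.sum_congr rfl fun i _ => ?_
    rw [hΛ]
  have h2 : Up = L * Matrix.diagonal (fun k => lam k p) * B := by
    ext j k
    rw [hUp j (hmem j).2 k, hU, Matrix.mul_apply, Matrix.mul_apply]
    refine Finset.sum_congr rfl fun i _ => ?_
    rw [hΛ, Matrix.mul_diagonal]
    congr 1
    simp only [L, Pi.add_apply]
    simp_rw [zpow_add₀ (hlam i _)]
    rw [Finset.prod_mul_distrib]
    congr 1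
    rw [Finset.prod_eq_single p]
    · simp
    · intro b _ hb
      simp [Pi.single_eq_of_ne hb]
    · simp
  have hL : Function.Injective L.mulVec := Matrix.mulVec_injective_iff.2 hind
  have hBi : Function.Injective B.mulVec := Matrix.mulVec_injective_of_isUnit hB
  have hUi : Function.Injective Um.mulVec := by
    intro x y hxy
    rw [h1, ← Matrix.mulVec_mulVec, ← Matrix.mulVec_mulVec] at hxy
    exact hBi (hL hxy)
  have hunit : IsUnit (Umᴴ * Um) :=
    open scoped ComplexOrder in (Matrix.PosDef.conjTranspose_mul_self Um hUi).isUnit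
  refine ⟨hunit, ?_⟩
  have h3 : Up = Um * (B⁻¹ * Matrix.diagonal (fun k => lam k p) * B) := by
    rw [h2, h1]
    simp only [Matrix.mul_assoc]
    rw [Matrix.mul_nonsing_inv_cancel_left _ _ hBdet]
  rw [h3, Matrix.mul_assoc, ← Matrix.mul_assoc Umᴴ,
    Matrix.nonsing_inv_mul_cancel_left _ _ ((Matrix.isUnit_iff_isUnit_det _).1 hunit)]
end
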